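/- arXiv:2406.02847 — 5 statements merged into one kernel-verified Lean document; each statement's English description precedes it below -/
import Mathlib

section
/- Let W_Q, W_K ∈ ℝ^{d_in×d_K}, W_V ∈ ℝ^{d_in×d_V}, let X' ∈ ℝ^{M×d_in} be an ICL prompt, and let b ∈ ℝ^{d_K×d_V} be a bias matrix. Set b' = b + W_K^T X'^T X' W_V. Then for every input X ∈ ℝ^{N×d_in} and every i ∈ {1,…,N}, row M+i of LinAttn([X';X]W_Q, [X';X]W_K, [X';X]W_V, b) equals row i of LinAttn(X W_Q, X W_K, X W_V, b'). (Bias conversion for linear attention, Theorem 4.2.) -/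
open Matrix

/-- Vertical concatenation `[A; B]` of token matrices (tokens are rows). -/
def vcat {M N d : ℕ} (A : Matrix (Fin M) (Fin d) ℝ) (B : Matrix (Fin N) (Fin d) ℝ) :
    Matrix (Fin (M + N)) (Fin d) ℝ :=
  Matrix.of (Fin.append A B)

/-- Linear attention with a Key-Value bias: `LinAttn(Q,K,V,b) = Q (Kᵀ V + b)`. -/
def linAttn {L dK dV : ℕ} (Q K : Matrix (Fin L) (Fin dK) ℝ)
    (V : Matrix (Fin L) (Fin dV) ℝ) (b : Matrix (Fin dK) (Fin dV) ℝ) :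
    Matrix (Fin L) (Fin dV) ℝ :=
  Q * (Kᵀ * V + b)

@[simp]
theorem vcat_castAdd {M N d : ℕ} (A : Matrix (Fin M) (Fin d) ℝ) (B : Matrix (Fin N) (Fin d) ℝ)
    (i : Fin M) : vcat A B (Fin.castAdd N i) = A i :=
  Fin.append_left A B i

@[simp]
theorem vcat_natAdd {M N d : ℕ} (A : Matrix (Fin M) (Fin d) ℝ) (B : Matrix (Fin N) (Fin d) ℝ)
    (i : Fin N) : vcat A B (Fin.natAdd M i) = B i :=
  Fin.append_right A B i

/-- The Gram product of a vertical concatenation is the sum of the Gram products of its blocks. -/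
theorem vcat_transpose_mul_vcat {M N d e : ℕ}
    (A : Matrix (Fin M) (Fin d) ℝ) (B : Matrix (Fin N) (Fin d) ℝ)
    (C : Matrix (Fin M) (Fin e) ℝ) (D : Matrix (Fin N) (Fin e) ℝ) :
    (vcat A B)ᵀ * vcat C D = Aᵀ * C + Bᵀ * D := by
  ext i j
  simp [Matrix.mul_apply, Fin.sum_univ_add]

/-- Right multiplication acts blockwise on a vertical concatenation. -/
theorem vcat_mul {M N d e : ℕ}
    (A : Matrix (Fin M) (Fin d) ℝ) (B : Matrix (Fin N) (Fin d) ℝ)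
    (W : Matrix (Fin d) (Fin e) ℝ) :
    vcat A B * W = vcat (A * W) (B * W) := by
  ext i j
  refine Fin.addCases (fun k => ?_) (fun k => ?_) i <;> simp [Matrix.mul_apply]

/-- **Bias conversion for linear attention** (Theorem 4.2): with
`b' = b + WKᵀ X'ᵀ X' WV`, for every input `X` and every position `i`, row `M+i` of
`LinAttn([X';X]W_Q, [X';X]W_K, [X';X]W_V, b)` equals row `i` of
`LinAttn(X W_Q, X W_K, X W_V, b')`. -/
theorem linAttn_bias_conversion {din dK dV M N : ℕ}
    (WQ WK : Matrix (Fin din) (Fin dK) ℝ) (WV : Matrix (Fin din) (Fin dV) ℝ)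
    (X' : Matrix (Fin M) (Fin din) ℝ)
    (b b' : Matrix (Fin dK) (Fin dV) ℝ)
    (hb' : b' = b + WKᵀ * X'ᵀ * X' * WV)
    (X : Matrix (Fin N) (Fin din) ℝ) (i : Fin N) :
    linAttn (vcat X' X * WQ) (vcat X' X * WK) (vcat X' X * WV) b (Fin.natAdd M i)
      = linAttn (X * WQ) (X * WK) (X * WV) b' i := by
  have hb : (vcat X' X * WK)ᵀ * (vcat X' X * WV) + b = (X * WK)ᵀ * (X * WV) + b' := by
    rw [vcat_mul, vcat_mul, vcat_transpose_mul_vcat, hb']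
    simp only [Matrix.transpose_mul, Matrix.mul_assoc]
    abel
  rw [linAttn, linAttn, hb, vcat_mul, vcat_mul, vcat_natAdd]
end

section
/- Fix weights W_Q, W_K ∈ ℝ^{d_in×d_K}, W_V ∈ ℝ^{d_in×d_V} with d_K even, an ICL prompt X' ∈ ℝ^{M×d_in}, and a bias b ∈ ℝ^{d_K×d_V}. Define b' = R_{Θ,−M} b + Σ_{j=1}^{M} R_{Θ,j−M} K'_j V'^T_j, where K'_j = X'_j W_K and V'_j = X'_j W_V. Then for every X ∈ ℝ^{N×d_in} and every i ∈ {1,…,N}: O_{M+i}([X';X], b) = O_i(X, b'). (Exact ICL conversion for masked linear attention with rotary positional encoding and trivial normalizer, the RetNet-type instance of the main theorem.) -/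
open Matrix

/-- The rotary (RoPE) matrix `R_{Θ,m} ∈ ℝ^{d×d}` for even `d = 2*h`, angles
`θ : Fin h → ℝ` and shift `m : ℤ`: block-diagonal with `t`-th 2×2 block
`[[cos(mθ_t), −sin(mθ_t)], [sin(mθ_t), cos(mθ_t)]]`. -/
noncomputable def rotary (h : ℕ) (θ : Fin h → ℝ) (m : ℤ) :
    Matrix (Fin (2 * h)) (Fin (2 * h)) ℝ :=
  Matrix.of fun i j =>
    if i.val / 2 = j.val / 2 then
      if i.val % 2 = 0 then
        if j.val % 2 = 0 then Real.cos ((m : ℝ) * θ ⟨i.val / 2, by have := i.isLt; omega⟩)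
        else -Real.sin ((m : ℝ) * θ ⟨i.val / 2, by have := i.isLt; omega⟩)
      else
        if j.val % 2 = 0 then Real.sin ((m : ℝ) * θ ⟨i.val / 2, by have := i.isLt; omega⟩)
        else Real.cos ((m : ℝ) * θ ⟨i.val / 2, by have := i.isLt; omega⟩)
    else 0

/-- Masked linear attention with rotary positional encoding and Key-Value bias
(feature map = identity, normalizer ≡ 1):
`O_i(Z, b)ᵀ = (R_{Θ,i} Q_i)ᵀ (Σ_{j=1}^{i} R_{Θ,j} K_j V_jᵀ + b)`. -/
noncomputable def linAttnRopeOut {L din dV h : ℕ} (θ : Fin h → ℝ)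
    (WQ WK : Matrix (Fin din) (Fin (2 * h)) ℝ) (WV : Matrix (Fin din) (Fin dV) ℝ)
    (Z : Matrix (Fin L) (Fin din) ℝ)
    (b : Matrix (Fin (2 * h)) (Fin dV) ℝ) (i : Fin L) : Fin dV → ℝ :=
  Matrix.vecMul ((rotary h θ (i.val + 1)).mulVec (Matrix.vecMul (Z i) WQ))
    ((∑ j ∈ Finset.Iic i,
        Matrix.vecMulVec ((rotary h θ (j.val + 1)).mulVec (Matrix.vecMul (Z j) WK))
          (Matrix.vecMul (Z j) WV)) + b)

theorem rotary_transpose {h : ℕ} (θ : Fin h → ℝ) (m : ℤ) :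
    (rotary h θ m)ᵀ = rotary h θ (-m) := by
  ext i j
  simp only [rotary, Matrix.transpose_apply, Matrix.of_apply, Int.cast_neg, neg_mul,
    Real.cos_neg, Real.sin_neg, neg_neg]
  by_cases hij : i.val / 2 = j.val / 2
  · simp only [hij, if_true]
    split_ifs <;> rfl
  · rw [if_neg hij, if_neg (Ne.symm hij)]

theorem rotary_mul_rotary {h : ℕ} (θ : Fin h → ℝ) (m n : ℤ) :
    rotary h θ m * rotary h θ n = rotary h θ (m + n) := by
  ext i j
  have hi := i.isLt
  rw [Matrix.mul_apply, Fintype.sum_eq_add (⟨2 * (i.val / 2), by omega⟩ : Fin (2 * h))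
    ⟨2 * (i.val / 2) + 1, by omega⟩ (by simp)]
  · have h₁ : 2 * (i.val / 2) / 2 = i.val / 2 := by omega
    have h₂ : (2 * (i.val / 2) + 1) / 2 = i.val / 2 := by omega
    have h₃ : (2 * (i.val / 2) + 1) % 2 = 1 := by omega
    simp only [rotary, Matrix.of_apply, h₁, h₂, h₃, Nat.mul_mod_right, if_true, one_ne_zero,
      if_false, Int.cast_add, add_mul, Real.cos_add, Real.sin_add]
    split_ifs <;> ring
  · rintro k ⟨hk₁, hk₂⟩
    have hk : i.val / 2 ≠ k.val / 2 := by
      simp only [ne_eq, Fin.ext_iff] at hk₁ hk₂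
      omega
    simp [rotary, hk]

theorem Fin.sum_Iic_natAdd {α : Type*} [AddCommMonoid α] {M N : ℕ} (f : Fin (M + N) → α)
    (i : Fin N) :
    ∑ j ∈ Finset.Iic (Fin.natAdd M i), f j
      = ∑ j : Fin M, f (Fin.castAdd N j) + ∑ j ∈ Finset.Iic i, f (Fin.natAdd M j) := by
  have hle (j : Fin M) : Fin.castAdd N j ≤ Fin.natAdd M i := by
    simp only [Fin.le_def, Fin.val_castAdd, Fin.val_natAdd]
    omega
  rw [← Finset.filter_ge_eq_Iic, ← Finset.filter_ge_eq_Iic, Finset.sum_filter,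
    Finset.sum_filter, Fin.sum_univ_add]
  simp [hle]

/-- **Exact ICL conversion for masked linear attention with RoPE and trivial
normalizer** (RetNet-type instance of the main theorem): with
`b' = R_{Θ,−M} b + Σ_{j=1}^{M} R_{Θ,j−M} K'_j V'_jᵀ`, the output at position `M+i`
of the concatenated input `[X'; X]` with bias `b` equals the output at position
`i` of `X` alone with bias `b'`. -/
theorem icl_conversion_linear_attention_rope {din dV h M N : ℕ}
    (θ : Fin h → ℝ)
    (WQ WK : Matrix (Fin din) (Fin (2 * h)) ℝ) (WV : Matrix (Fin din) (Fin dV) ℝ)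
    (X' : Matrix (Fin M) (Fin din) ℝ)
    (b b' : Matrix (Fin (2 * h)) (Fin dV) ℝ)
    (hb' : b' = rotary h θ (-(M : ℤ)) * b
      + ∑ j : Fin M,
          Matrix.vecMulVec
            ((rotary h θ ((j.val + 1 : ℤ) - M)).mulVec (Matrix.vecMul (X' j) WK))
            (Matrix.vecMul (X' j) WV))
    (X : Matrix (Fin N) (Fin din) ℝ) (i : Fin N) :
    linAttnRopeOut θ WQ WK WV (vcat X' X) b (Fin.natAdd M i)
      = linAttnRopeOut θ WQ WK WV X b' i := by
  have hQ (v : Fin (2 * h) → ℝ) :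
      rotary h θ (((Fin.natAdd M i).val : ℤ) + 1) *ᵥ v
        = (rotary h θ (i.val + 1) *ᵥ v) ᵥ* rotary h θ (-(M : ℤ)) := by
    rw [← rotary_transpose, Matrix.vecMul_transpose, Matrix.mulVec_mulVec, rotary_mul_rotary,
      Fin.val_natAdd]
    push_cast
    rw [add_assoc]
  have hR (j : Fin N) :
      -(M : ℤ) + (((Fin.natAdd M j).val : ℤ) + 1) = j.val + 1 := by
    rw [Fin.val_natAdd]
    push_cast
    ring
  have hL (j : Fin M) :
      -(M : ℤ) + (((Fin.castAdd N j).val : ℤ) + 1) = (j.val + 1 : ℤ) - M := by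
    rw [Fin.val_castAdd]
    ring
  have hX (j : Fin N) : vcat X' X (Fin.natAdd M j) = X j := Fin.append_right X' X j
  have hX' (j : Fin M) : vcat X' X (Fin.castAdd N j) = X' j := Fin.append_left X' X j
  unfold linAttnRopeOut
  rw [hQ, Matrix.vecMul_vecMul, hb', Fin.sum_Iic_natAdd]
  simp only [Matrix.mul_add, Matrix.mul_sum, Matrix.mul_vecMulVec, Matrix.mulVec_mulVec,
    rotary_mul_rotary, hR, hL, hX, hX']
  congr 1
  abel
end

section
/- For every even positive integer d, all angles θ_1,…,θ_{d/2} ∈ ℝ, all shifts m, n ∈ ℤ, and all vectors x, y ∈ ℝ^d: (R_{Θ,m} x)^T (R_{Θ,n} y) = x^T R_{Θ,n−m} y. In other words, the inner product between rotary-encoded vectors depends only on the relative shift n − m. -/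
open Matrix

/-- Position `2 * t + a` of a vector, seen as coordinate `a` of the `t`-th pair. -/
def pairEquiv (h : ℕ) : Fin 2 × Fin h ≃ Fin (2 * h) :=
  (Equiv.prodComm _ _).trans (finProdFinEquiv.trans (finCongr (mul_comm h 2)))

/-- The `2 × 2` matrix of the rotation by the angle `φ`. -/
noncomputable def planeRotation (φ : ℝ) : Matrix (Fin 2) (Fin 2) ℝ :=
  !![Real.cos φ, -Real.sin φ; Real.sin φ, Real.cos φ]

theorem planeRotation_transpose_mul (φ ψ : ℝ) :
    (planeRotation φ)ᵀ * planeRotation ψ = planeRotation (ψ - φ) := by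
  ext i j
  fin_cases i <;> fin_cases j <;>
    simp [planeRotation, Matrix.mul_apply, Fin.sum_univ_two, Real.cos_sub, Real.sin_sub] <;> ring

theorem rotary_eq_reindex_blockDiagonal (h : ℕ) (θ : Fin h → ℝ) (m : ℤ) :
    rotary h θ m = Matrix.reindex (pairEquiv h) (pairEquiv h)
      (Matrix.blockDiagonal fun t => planeRotation (m * θ t)) := by
  rw [← Equiv.symm_apply_eq]
  ext ⟨a, s⟩ ⟨b, t⟩
  have hdiv (c : Fin 2) (u : Fin h) : (pairEquiv h (c, u)).val / 2 = u.val := by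
    simp [pairEquiv]; omega
  have hmod (c : Fin 2) (u : Fin h) : (pairEquiv h (c, u)).val % 2 = c.val := by
    simp [pairEquiv]; omega
  simp only [Matrix.reindex_symm, Matrix.reindex_apply, Equiv.symm_symm, Matrix.submatrix_apply,
    rotary, Matrix.of_apply, hdiv, hmod, Fin.eta, Matrix.blockDiagonal_apply, Fin.val_inj]
  fin_cases a <;> fin_cases b <;> simp [planeRotation]

theorem rotary_transpose_mul (h : ℕ) (θ : Fin h → ℝ) (m n : ℤ) :
    (rotary h θ m)ᵀ * rotary h θ n = rotary h θ (n - m) := by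
  simp only [rotary_eq_reindex_blockDiagonal, Matrix.reindex_apply, Matrix.transpose_submatrix,
    Matrix.submatrix_mul_equiv, Matrix.blockDiagonal_transpose, ← Matrix.blockDiagonal_mul,
    planeRotation_transpose_mul, Int.cast_sub, sub_mul]

/-- The inner product between rotary-encoded vectors depends only on the relative
shift: `(R_{Θ,m} x)ᵀ (R_{Θ,n} y) = xᵀ R_{Θ,n−m} y`. -/
theorem rotary_inner_relative {h : ℕ} (hpos : 0 < h) (θ : Fin h → ℝ) (m n : ℤ)
    (x y : Fin (2 * h) → ℝ) :
    (rotary h θ m).mulVec x ⬝ᵥ (rotary h θ n).mulVec y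
      = x ⬝ᵥ (rotary h θ (n - m)).mulVec y := by
  rw [← rotary_transpose_mul, ← Matrix.mulVec_mulVec, Matrix.dotProduct_mulVec x,
    Matrix.vecMul_transpose]
end

section
/- Fix weights W_Q, W_K ∈ ℝ^{d_in×d_K}, W_V ∈ ℝ^{d_in×d_V} with d_K even, a feature map φ: ℝ^{d_K} → ℝ^{d_K}, functions D_1: ℝ^{d_K} → ℝ^p and ψ: ℝ^{d_in} → ℝ^p, and biases b_KV ∈ ℝ^{d_K×d_V}, b_D ∈ ℝ^p. For an input Z ∈ ℝ^{L×d_in} with Q_i = Z_i W_Q, K_i = Z_i W_K, V_i = Z_i W_V, define recursively s_0 = b_KV, s_i = s_{i−1} + R_{Θ,i} φ(K_i) V_i^T, and z_0 = b_D, z_i = z_{i−1} + ψ(Z_i), and set y_i^T = (R_{Θ,i} φ(Q_i))^T s_i / (D_1(Q_i)^T z_i). Then for every i ∈ {1,…,L}, y_i equals the output O_i(Z, b_KV, b_D) of the masked linearized attention layer with rotary positional encoding, bias terms b_KV, b_D, and cumulative normalizer D_2(Z,i) = Σ_{j=1}^{i} ψ(Z_j). In particular, adding the bias terms b_KV, b_D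 is equivalent to initializing the hidden states of the RNN representation at s_0 = b_KV and z_0 = b_D. (Transformers-as-RNNs representation, Section 7.) -/
open Matrix

/-- The rotary-encoded Key-Value matrix of input `Z` up to position `i`:
`Σ_{j=1}^{i} R_{Θ,j} φ(K_j) V_jᵀ`. -/
noncomputable def kvSum {L din dV h : ℕ} (θ : Fin h → ℝ)
    (WK : Matrix (Fin din) (Fin (2 * h)) ℝ) (WV : Matrix (Fin din) (Fin dV) ℝ)
    (φ : (Fin (2 * h) → ℝ) → (Fin (2 * h) → ℝ))
    (Z : Matrix (Fin L) (Fin din) ℝ) (i : Fin L) : Matrix (Fin (2 * h)) (Fin dV) ℝ :=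
  ∑ j ∈ Finset.Iic i,
    Matrix.vecMulVec ((rotary h θ (j.val + 1)).mulVec (φ (Matrix.vecMul (Z j) WK)))
      (Matrix.vecMul (Z j) WV)

/-- Masked linearized attention with rotary positional encoding and bias terms:
`O_i(Z, b_KV, b_D)ᵀ = (R_{Θ,i} φ(Q_i))ᵀ (Σ_{j=1}^{i} R_{Θ,j} φ(K_j) V_jᵀ + b_KV)
  / (D_1(Q_i)ᵀ (D_2(Z,i) + b_D))`. -/
noncomputable def attnOut {L din dV p h : ℕ} (θ : Fin h → ℝ)
    (WQ WK : Matrix (Fin din) (Fin (2 * h)) ℝ) (WV : Matrix (Fin din) (Fin dV) ℝ)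
    (φ : (Fin (2 * h) → ℝ) → (Fin (2 * h) → ℝ))
    (D1 : (Fin (2 * h) → ℝ) → (Fin p → ℝ))
    (D2 : Matrix (Fin L) (Fin din) ℝ → Fin L → (Fin p → ℝ))
    (Z : Matrix (Fin L) (Fin din) ℝ)
    (bKV : Matrix (Fin (2 * h)) (Fin dV) ℝ) (bD : Fin p → ℝ) (i : Fin L) :
    Fin dV → ℝ :=
  fun v =>
    Matrix.vecMul ((rotary h θ (i.val + 1)).mulVec (φ (Matrix.vecMul (Z i) WQ)))
      (kvSum θ WK WV φ Z i + bKV) v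
    / (D1 (Matrix.vecMul (Z i) WQ) ⬝ᵥ (D2 Z i + bD))

/-- A sequence whose successive increments are `f` equals its initial value plus the
partial sums of `f`. -/
theorem eq_sum_Iic_add_of_succ {M : Type*} [AddCommMonoid M] {L : ℕ} {u : ℕ → M}
    {f : Fin L → M} (hu : ∀ i : Fin L, u (i.val + 1) = u i.val + f i) (i : Fin L) :
    u (i.val + 1) = ∑ j ∈ Finset.Iic i, f j + u 0 := by
  obtain ⟨n, hn⟩ := i
  induction n with
  | zero =>
    have h : Finset.Iic (⟨0, hn⟩ : Fin L) = {⟨0, hn⟩} := by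
      ext j
      simp [Fin.le_def, Fin.ext_iff]
    rw [hu ⟨0, hn⟩, h, Finset.sum_singleton, add_comm]
  | succ n ih =>
    have h : Finset.Iic (⟨n + 1, hn⟩ : Fin L) =
        insert ⟨n + 1, hn⟩ (Finset.Iic ⟨n, by omega⟩) := by
      ext j
      simp only [Finset.mem_Iic, Finset.mem_insert, Fin.le_def, Fin.ext_iff]
      omega
    have ih' : u (n + 1) = _ := ih (by omega)
    rw [hu ⟨n + 1, hn⟩, ih', h, Finset.sum_insert (by simp [Fin.le_def]), add_comm, add_assoc]

/-- **Transformers-as-RNNs representation** (Section 7): the recursively defined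
hidden states `s_0 = b_KV`, `s_i = s_{i−1} + R_{Θ,i} φ(K_i) V_iᵀ`,
`z_0 = b_D`, `z_i = z_{i−1} + ψ(Z_i)` with outputs
`y_iᵀ = (R_{Θ,i} φ(Q_i))ᵀ s_i / (D_1(Q_i)ᵀ z_i)` reproduce, at every position `i`,
the output of masked linearized attention with RoPE, biases `b_KV, b_D` and
cumulative normalizer `D_2(Z,i) = Σ_{j=1}^{i} ψ(Z_j)`; i.e. adding the bias terms
amounts to initializing the hidden states of the RNN at `s_0 = b_KV`, `z_0 = b_D`. -/
theorem transformer_as_rnn {L din dV p h : ℕ} (θ : Fin h → ℝ)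
    (WQ WK : Matrix (Fin din) (Fin (2 * h)) ℝ) (WV : Matrix (Fin din) (Fin dV) ℝ)
    (φ : (Fin (2 * h) → ℝ) → (Fin (2 * h) → ℝ))
    (D1 : (Fin (2 * h) → ℝ) → (Fin p → ℝ))
    (ψ : (Fin din → ℝ) → (Fin p → ℝ))
    (bKV : Matrix (Fin (2 * h)) (Fin dV) ℝ) (bD : Fin p → ℝ)
    (Z : Matrix (Fin L) (Fin din) ℝ)
    (s : ℕ → Matrix (Fin (2 * h)) (Fin dV) ℝ)
    (z : ℕ → Fin p → ℝ)
    (y : Fin L → Fin dV → ℝ)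
    (hs0 : s 0 = bKV)
    (hs : ∀ i : Fin L, s (i.val + 1) = s i.val
      + Matrix.vecMulVec ((rotary h θ (i.val + 1)).mulVec (φ (Matrix.vecMul (Z i) WK)))
          (Matrix.vecMul (Z i) WV))
    (hz0 : z 0 = bD)
    (hz : ∀ i : Fin L, z (i.val + 1) = z i.val + ψ (Z i))
    (hy : ∀ i : Fin L, y i = fun v =>
      Matrix.vecMul ((rotary h θ (i.val + 1)).mulVec (φ (Matrix.vecMul (Z i) WQ)))
          (s (i.val + 1)) v
        / (D1 (Matrix.vecMul (Z i) WQ) ⬝ᵥ z (i.val + 1))) :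
    ∀ i : Fin L,
      y i = attnOut θ WQ WK WV φ D1
        (fun Z' i' => ∑ j ∈ Finset.Iic i', ψ (Z' j)) Z bKV bD i := by
  intro i
  rw [hy i, eq_sum_Iic_add_of_succ hs i, eq_sum_Iic_add_of_succ hz i, hs0, hz0]
  rfl
end

section
/- Fix weights W_K ∈ ℝ^{d_in×d_K}, W_V ∈ ℝ^{d_in×d_V} with d_K even and a feature map φ: ℝ^{d_K} → ℝ^{d_K}. For an ICL prompt P ∈ ℝ^{M×d_in}, define the bias-update map T_P: ℝ^{d_K×d_V} → ℝ^{d_K×d_V} by T_P(b) = R_{Θ,−M} b + Σ_{j=1}^{M} R_{Θ,j−M} φ(P_j W_K) (P_j W_V)^T. Then for all ICL prompts X' ∈ ℝ^{M'×d_in} and X'' ∈ ℝ^{M''×d_in} and every b ∈ ℝ^{d_K×d_V}: T_{X''}(T_{X'}(b)) = T_{[X';X'']}(b), where [X';X''] ∈ ℝ^{(M'+M'')×d_in} is the vertical concatenation with X' on top. In other words, the converted Key-Value bias terms compose: applying the conversion with prompt X' and then with prompt X'' equals applying the single conversion with the concatenated prompt [X';X'']. (Composability of converted biases.) -/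
open Matrix

/-- The bias-update map of the exact ICL conversion theorem for a prompt `P` of
length `M`: `T_P(b) = R_{Θ,−M} b + Σ_{j=1}^{M} R_{Θ,j−M} φ(P_j W_K) (P_j W_V)ᵀ`. -/
noncomputable def biasUpdate {din dV h M : ℕ} (θ : Fin h → ℝ)
    (WK : Matrix (Fin din) (Fin (2 * h)) ℝ) (WV : Matrix (Fin din) (Fin dV) ℝ)
    (φ : (Fin (2 * h) → ℝ) → (Fin (2 * h) → ℝ))
    (P : Matrix (Fin M) (Fin din) ℝ)
    (b : Matrix (Fin (2 * h)) (Fin dV) ℝ) : Matrix (Fin (2 * h)) (Fin dV) ℝ :=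
  rotary h θ (-(M : ℤ)) * b
    + ∑ j : Fin M,
        Matrix.vecMulVec
          ((rotary h θ ((j.val + 1 : ℤ) - M)).mulVec (φ (Matrix.vecMul (P j) WK)))
          (Matrix.vecMul (P j) WV)

/-- Coordinates of `Fin (2 * h)` as a block index together with a position in the block. -/
def blockEquiv (h : ℕ) : Fin h × Fin 2 ≃ Fin (2 * h) :=
  finProdFinEquiv.trans (finCongr (Nat.mul_comm h 2))

theorem rotary_blockEquiv (h : ℕ) (θ : Fin h → ℝ) (m : ℤ) (t u : Fin h) (r s : Fin 2) :
    rotary h θ m (blockEquiv h (t, r)) (blockEquiv h (u, s)) =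
      if t = u then
        !![Real.cos (m * θ t), -Real.sin (m * θ t); Real.sin (m * θ t), Real.cos (m * θ t)] r s
      else 0 := by
  have hdiv (a : ℕ) (r : Fin 2) : (r.val + 2 * a) / 2 = a := by lia
  have hmod (a : ℕ) (r : Fin 2) : (r.val + 2 * a) % 2 = r.val := by lia
  simp only [rotary, blockEquiv, Matrix.of_apply, Equiv.trans_apply, finProdFinEquiv_apply_val,
    finCongr_apply, Fin.val_cast, hdiv, hmod, Fin.val_inj, Fin.eta]
  fin_cases r <;> fin_cases s <;> simp

/-- Rotary matrices turn addition of shifts into matrix multiplication. -/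
theorem rotary_add (h : ℕ) (θ : Fin h → ℝ) (m n : ℤ) :
    rotary h θ (m + n) = rotary h θ m * rotary h θ n := by
  ext i j
  obtain ⟨⟨t, r⟩, rfl⟩ := (blockEquiv h).surjective i
  obtain ⟨⟨u, s⟩, rfl⟩ := (blockEquiv h).surjective j
  rw [Matrix.mul_apply, ← (blockEquiv h).sum_comp, Fintype.sum_prod_type]
  simp only [rotary_blockEquiv, Fin.sum_univ_two, ite_mul, zero_mul, mul_ite, mul_zero]
  by_cases htu : t = u
  · subst htu
    fin_cases r <;> fin_cases s <;>
      simp [Finset.sum_add_distrib, add_mul, Real.cos_add, Real.sin_add] <;> ring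
  · have hsum : ∀ k, ¬ (t = k ∧ k = u) := fun k hk => htu (hk.1.trans hk.2)
    rw [if_neg htu]
    refine (Finset.sum_eq_zero fun k _ => ?_).symm
    specialize hsum k
    split_ifs <;> simp_all

/-- **Composability of converted biases**: applying the conversion with prompt
`X'` and then with prompt `X''` equals applying the single conversion with the
concatenated prompt `[X'; X'']`, i.e. `T_{X''} ∘ T_{X'} = T_{[X';X'']}`. -/
theorem biasUpdate_comp {din dV h M' M'' : ℕ} (θ : Fin h → ℝ)
    (WK : Matrix (Fin din) (Fin (2 * h)) ℝ) (WV : Matrix (Fin din) (Fin dV) ℝ)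
    (φ : (Fin (2 * h) → ℝ) → (Fin (2 * h) → ℝ))
    (X' : Matrix (Fin M') (Fin din) ℝ) (X'' : Matrix (Fin M'') (Fin din) ℝ)
    (b : Matrix (Fin (2 * h)) (Fin dV) ℝ) :
    biasUpdate θ WK WV φ X'' (biasUpdate θ WK WV φ X' b)
      = biasUpdate θ WK WV φ (vcat X' X'') b := by
  have hX' (j : Fin M') : vcat X' X'' (Fin.castAdd M'' j) = X' j := Fin.append_left X' X'' j
  have hX'' (j : Fin M'') : vcat X' X'' (Fin.natAdd M' j) = X'' j := Fin.append_right X' X'' j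
  simp only [biasUpdate, Fin.sum_univ_add, hX', hX'', Matrix.mul_add, Matrix.mul_sum,
    ← Matrix.mul_assoc, ← rotary_add, Matrix.mul_vecMulVec, Matrix.mulVec_mulVec, ← add_assoc,
    Fin.val_castAdd, Fin.val_natAdd]
  have hb : -(M'' : ℤ) + -(M' : ℤ) = -((M' + M'' : ℕ) : ℤ) := by push_cast; ring
  have hl (j : ℕ) : -(M'' : ℤ) + (j + 1 - M') = j + 1 - (M' + M'' : ℕ) := by push_cast; ring
  have hr (j : ℕ) : (j : ℤ) + 1 - M'' = (M' + j : ℕ) + 1 - (M' + M'' : ℕ) := by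
    push_cast; ring
  simp only [hb, hl, hr]
end
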